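/- A cubic graph admits a (5,0)-flow if and only if it admits an (r, (5−r)/3)-flow for every real r with 2≤r≤5. -/

import Mathlib

open Finset
open scoped Classical

namespace BEF

variable {V : Type*}

/-- An orientation of a simple graph: each edge gets exactly one direction. -/
structure Orientation (G : SimpleGraph V) where
  dir : V → V → Prop
  adj_of_dir : ∀ u v, dir u v → G.Adj u v
  dir_iff_not : ∀ u v, G.Adj u v → (dir u v ↔ ¬ dir v u)

/-- Net outflow (excess) of `f` at vertex `x` in orientation `D`. -/
noncomputable def excess [Fintype V] {G : SimpleGraph V}
    (D : Orientation G) (f : Sym2 V → ℝ) (x : V) : ℝ :=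
  (∑ y : V, if D.dir x y then f s(x, y) else 0)
    - (∑ y : V, if D.dir y x then f s(x, y) else 0)

/-- `f` is an `(r, α)`-bounded-excess flow in the orientation `D` of `G`. -/
def IsBEFlow [Fintype V] {G : SimpleGraph V}
    (D : Orientation G) (r α : ℝ) (f : Sym2 V → ℝ) : Prop :=
  (∀ e ∈ G.edgeSet, 1 ≤ f e ∧ f e ≤ r - 1) ∧ ∀ x : V, |excess D f x| ≤ α

/-- `G` admits an `(r, α)`-flow. -/
def HasFlow [Fintype V] (G : SimpleGraph V) (r α : ℝ) : Prop :=
  ∃ D : Orientation G, ∃ f : Sym2 V → ℝ, IsBEFlow D r α f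

/-- Outdegree of a vertex in an orientation. -/
noncomputable def outDeg {G : SimpleGraph V} (D : Orientation G) (x : V) : ℕ :=
  {y | D.dir x y}.ncard

/-- A cubic graph: every vertex has exactly 3 neighbours. -/
def IsCubic (G : SimpleGraph V) : Prop :=
  ∀ v : V, (G.neighborSet v).ncard = 3

/-- A bisection: a partition of the vertex set into two parts of equal size. -/
def IsBisection [Fintype V] (V₁ V₂ : Set V) : Prop :=
  Disjoint V₁ V₂ ∧ V₁ ∪ V₂ = Set.univ ∧ V₁.ncard = V₂.ncard

/-- The bisection `(V₁, V₂)` of `G` is orientable. -/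
def Orientable (G : SimpleGraph V) (V₁ V₂ : Set V) : Prop :=
  ∃ D : Orientation G, (∀ v ∈ V₁, outDeg D v = 1) ∧ (∀ v ∈ V₂, outDeg D v = 2)

/-- `d(A)`: the number of edges of `G` with exactly one endvertex in `A`. -/
noncomputable def cutCard (G : SimpleGraph V) (A : Set V) : ℕ :=
  {e ∈ G.edgeSet | ∃ u ∈ A, ∃ v ∉ A, e = s(u, v)}.ncard

/-- `Δ(A) = | |V₂ ∩ A| - |V₁ ∩ A| |` (as an integer). -/
noncomputable def disc (V₁ V₂ A : Set V) : ℤ :=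
  |((V₂ ∩ A).ncard : ℤ) - ((V₁ ∩ A).ncard : ℤ)|

/-- Every connected component of the subgraph induced on `S` is a tree on
at most `k - 2` vertices. -/
def WeakSide (G : SimpleGraph V) (k : ℕ) (S : Set V) : Prop :=
  (G.induce S).IsAcyclic ∧
    ∀ c : (G.induce S).ConnectedComponent, c.supp.ncard ≤ k - 2

/-- A `k`-weak bisection. -/
def KWeak [Fintype V] (G : SimpleGraph V) (k : ℕ) (V₁ V₂ : Set V) : Prop :=
  IsBisection V₁ V₂ ∧ WeakSide G k V₁ ∧ WeakSide G k V₂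

/-- A balanced orientation: every outdegree is 1 or 2. -/
def Balanced {G : SimpleGraph V} (D : Orientation G) : Prop :=
  ∀ v : V, outDeg D v = 1 ∨ outDeg D v = 2

/-- The excess as a difference of sums over the out-neighbours and the in-neighbours. -/
lemma excess_eq_sum_filter [Fintype V] {G : SimpleGraph V} (D : Orientation G)
    (f : Sym2 V → ℝ) (x : V) :
    excess D f x = ∑ y with D.dir x y, f s(x, y) - ∑ y with D.dir y x, f s(x, y) := by
  simp only [excess, Finset.sum_filter]

/-- In a cubic graph, the outdegree and the indegree of a vertex add up to `3`. -/
lemma card_out_add_card_in [Fintype V] {G : SimpleGraph V} (hG : IsCubic G)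
    (D : Orientation G) (x : V) :
    #{y | D.dir x y} + #{y | D.dir y x} = 3 := by
  rw [← hG x, ← Finset.card_union_of_disjoint, ← Set.ncard_coe_finset]
  · congr 1
    ext y
    simp only [Finset.coe_union, Finset.coe_filter, Finset.mem_univ, true_and, Set.mem_union,
      Set.mem_ofPred_eq, SimpleGraph.mem_neighborSet]
    refine ⟨fun h => h.elim (D.adj_of_dir x y) fun h => (D.adj_of_dir y x h).symm, fun h => ?_⟩
    have := D.dir_iff_not x y h
    tauto
  · refine Finset.disjoint_filter.2 fun y _ hxy hyx => ?_
    exact (D.dir_iff_not x y (D.adj_of_dir x y hxy)).1 hxy hyx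

/-- A flow with zero excess on a cubic graph has neither sources nor sinks, so the constant
function `1` has excess `±1` everywhere in its orientation. -/
lemma IsBEFlow.abs_excess_one_le [Fintype V] {G : SimpleGraph V} (hG : IsCubic G)
    {D : Orientation G} {r : ℝ} {f : Sym2 V → ℝ} (hf : IsBEFlow D r 0 f) (x : V) :
    |excess D (fun _ => 1) x| ≤ 1 := by
  have hcard := card_out_add_card_in hG D x
  have hzero : excess D f x = 0 := abs_nonpos_iff.1 (hf.2 x)
  rw [excess_eq_sum_filter] at hzero
  have hout : (#{y | D.dir x y} : ℝ) ≤ ∑ y with D.dir x y, f s(x, y) := by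
    rw [Finset.cast_card]
    refine Finset.sum_le_sum fun y hy => (hf.1 _ ?_).1
    exact D.adj_of_dir x y (Finset.mem_filter.1 hy).2
  have hin : (#{y | D.dir y x} : ℝ) ≤ ∑ y with D.dir y x, f s(x, y) := by
    rw [Finset.cast_card]
    refine Finset.sum_le_sum fun y hy => (hf.1 _ ?_).1
    exact (D.adj_of_dir y x (Finset.mem_filter.1 hy).2).symm
  have hcardR : (#{y | D.dir x y} : ℝ) + #{y | D.dir y x} = 3 := by exact_mod_cast hcard
  have hout_pos : 1 ≤ #{y | D.dir x y} := by
    by_contra! h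
    have h0 := Finset.card_eq_zero.1 (Nat.lt_one_iff.1 h)
    simp only [h0, Finset.sum_empty, Finset.card_empty, Nat.cast_zero] at *
    linarith
  have hin_pos : 1 ≤ #{y | D.dir y x} := by
    by_contra! h
    have h0 := Finset.card_eq_zero.1 (Nat.lt_one_iff.1 h)
    simp only [h0, Finset.sum_empty, Finset.card_empty, Nat.cast_zero] at *
    linarith
  have hout_posR : (1 : ℝ) ≤ #{y | D.dir x y} := by exact_mod_cast hout_pos
  have hin_posR : (1 : ℝ) ≤ #{y | D.dir y x} := by exact_mod_cast hin_pos
  rw [excess_eq_sum_filter, ← Finset.cast_card, ← Finset.cast_card, abs_le]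
  constructor <;> linarith

/-- The excess is linear in the flow. -/
lemma excess_linear_comb [Fintype V] {G : SimpleGraph V} (D : Orientation G)
    (a b : ℝ) (f g : Sym2 V → ℝ) (x : V) :
    excess D (fun e => a * f e + b * g e) x = a * excess D f x + b * excess D g x := by
  simp only [excess_eq_sum_filter, Finset.sum_add_distrib, ← Finset.mul_sum]
  ring

/-- a cubic graph admits a `(5,0)`-flow iff it admits an
`(r, (5-r)/3)`-flow for every `2 ≤ r ≤ 5`. -/
theorem stmt13 [Fintype V] (G : SimpleGraph V) (hG : IsCubic G) :
    HasFlow G 5 0 ↔ ∀ r : ℝ, 2 ≤ r → r ≤ 5 → HasFlow G r ((5 - r) / 3) := by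
  constructor
  · rintro ⟨D, f, hf⟩ r hr2 hr5
    refine ⟨D, fun e => (r - 2) / 3 * f e + (5 - r) / 3 * 1, fun e he => ?_, fun x => ?_⟩
    · obtain ⟨h1, h2⟩ := hf.1 e he
      constructor <;> nlinarith
    · rw [excess_linear_comb, abs_nonpos_iff.1 (hf.2 x), mul_zero, zero_add, abs_mul,
        abs_of_nonneg (by linarith : 0 ≤ (5 - r) / 3)]
      exact mul_le_of_le_one_right (by linarith) (hf.abs_excess_one_le hG x)
  · intro h
    simpa using h 5 (by norm_num) le_rfl

end BEF
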